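/- arXiv:2103.00875 — 2 statements merged into one kernel-verified Lean document; each statement's English description precedes it below -/
import Mathlib

section
/- Let n ≥ 2, let V be a finite set, and let Q₁,…,Qₙ be subsets of V such that each Qᵢ has exactly n elements, |Qᵢ ∩ Qⱼ| ≤ 1 whenever i ≠ j, every element of V lies in at least one Qᵢ, and every element of V lies in at most two of the sets Q₁,…,Qₙ. Let G be the simple graph on V in which two distinct vertices u, v are adjacent if and only if there exists some i with u ∈ Qᵢ and v ∈ Qᵢ. Then the chromatic number of G equals n. -/
/-- The sum of the indices of the sets `Q i` containing `v`, in `Fin n`. -/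
def indexSum {n : ℕ} [NeZero n] {V : Type*} [DecidableEq V] (Q : Fin n → Finset V) (v : V) :
    Fin n :=
  ∑ i with v ∈ Q i, i

/-- `indexSum` separates the elements of `Q i` that lie in exactly two members of the family. -/
theorem indexSum_injOn {n : ℕ} [NeZero n] {V : Type*} [DecidableEq V] (Q : Fin n → Finset V)
    (hinter : ∀ i j, i ≠ j → (Q i ∩ Q j).card ≤ 1) (i : Fin n) :
    Set.InjOn (indexSum Q)
      {v | v ∈ Q i ∧ (Finset.univ.filter (fun j => v ∈ Q j)).card = 2} := by
  have key : ∀ v, v ∈ Q i → (Finset.univ.filter (fun j => v ∈ Q j)).card = 2 →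
      ∃ j, j ≠ i ∧ v ∈ Q j ∧ indexSum Q v = i + j := by
    intro v hv h
    have hi : i ∈ Finset.univ.filter (fun j => v ∈ Q j) := by simpa using hv
    have hrest : ((Finset.univ.filter (fun j => v ∈ Q j)).erase i).card = 1 := by
      rw [Finset.card_erase_of_mem hi, h]
    obtain ⟨j, hj⟩ := Finset.card_eq_one.mp hrest
    have hjm : j ∈ (Finset.univ.filter (fun j => v ∈ Q j)).erase i := by simp [hj]
    refine ⟨j, Finset.ne_of_mem_erase hjm, by simpa using Finset.mem_of_mem_erase hjm, ?_⟩
    rw [indexSum, ← Finset.add_sum_erase _ _ hi, hj, Finset.sum_singleton]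
  rintro u ⟨hu, hu2⟩ v ⟨hv, hv2⟩ huv
  obtain ⟨j, hji, huj, hsu⟩ := key u hu hu2
  obtain ⟨k, -, hvk, hsv⟩ := key v hv hv2
  obtain rfl : j = k := by
    rw [hsu, hsv] at huv
    exact add_left_cancel huv
  exact Finset.card_le_one.mp (hinter i j hji.symm) u (Finset.mem_inter.mpr ⟨hu, huj⟩) v
    (Finset.mem_inter.mpr ⟨hv, hvk⟩)

/-- A map that is injective on part of a finite set `s` can be modified off that part to become
injective on `s`, provided the codomain is as large as `s`. -/
theorem Finset.exists_injOn_extend {α β : Type*} [Fintype β] (s : Finset α)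
    (hs : s.card = Fintype.card β) (p : α → Prop) (f : α → β)
    (hf : Set.InjOn f {a | a ∈ s ∧ p a}) :
    ∃ g : α → β, Set.InjOn g s ∧ ∀ a ∈ s, p a → g a = f a := by
  classical
  obtain ⟨g, hg⟩ := Finset.exists_equiv_extend_of_card_eq (α := s) (t := (Finset.univ : Finset β))
    (by simpa using hs) (s := Finset.univ.filter (fun a : s => p a)) (f := fun a => f a)
    (Finset.subset_univ _) (by
      intro a ha b hb hab
      exact Subtype.ext (hf ⟨a.2, by simpa using ha⟩ ⟨b.2, by simpa using hb⟩ hab))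
  refine ⟨fun a => if h : a ∈ s then (g ⟨a, h⟩ : β) else f a, ?_, ?_⟩
  · intro a ha b hb hab
    have ha' : a ∈ s := ha
    have hb' : b ∈ s := hb
    simp only [ha', hb', dif_pos] at hab
    exact congrArg Subtype.val (g.injective (Subtype.ext hab))
  · intro a ha hp
    simp only [ha, dif_pos]
    exact hg ⟨a, ha⟩ (by simpa using hp)

/-- Let `n ≥ 2` and let `V` be a finite set covered by `n` sets
`Q₁,…,Qₙ`, each of size `n`, pairwise intersecting in at most one element, and
such that every element of `V` lies in at most two of the `Qᵢ`. If `G` is the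
graph on `V` where two distinct vertices are adjacent iff they lie together in
some `Qᵢ`, then `χ(G) = n`. -/
theorem stmt_3 (n : ℕ) (hn : 2 ≤ n) (V : Type*) [Fintype V] [DecidableEq V]
    (Q : Fin n → Finset V)
    (hcard : ∀ i, (Q i).card = n)
    (hinter : ∀ i j, i ≠ j → (Q i ∩ Q j).card ≤ 1)
    (hcover : ∀ v : V, ∃ i, v ∈ Q i)
    (htwo : ∀ v : V, (Finset.univ.filter (fun i => v ∈ Q i)).card ≤ 2)
    (G : SimpleGraph V)
    (hG : ∀ u v, G.Adj u v ↔ u ≠ v ∧ ∃ i, u ∈ Q i ∧ v ∈ Q i) :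
    G.chromaticNumber = (n : ℕ∞) := by
  have : NeZero n := ⟨by omega⟩
  apply le_antisymm
  · have hext : ∀ i, ∃ g : V → Fin n, Set.InjOn g (Q i) ∧ ∀ v ∈ Q i,
        (Finset.univ.filter (fun j => v ∈ Q j)).card = 2 → g v = indexSum Q v := fun i =>
      Finset.exists_injOn_extend (Q i) (by simp [hcard]) _ _ (indexSum_injOn Q hinter i)
    choose g hginj hgsum using hext
    choose c hc using hcover
    have hgc : ∀ i, ∀ v ∈ Q i, g (c v) v = g i v := by
      intro i v hv
      by_cases h : (Finset.univ.filter (fun j => v ∈ Q j)).card = 2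
      · rw [hgsum _ v (hc v) h, hgsum i v hv h]
      · have hle : (Finset.univ.filter (fun j => v ∈ Q j)).card ≤ 1 := by
          have := htwo v
          omega
        rw [Finset.card_le_one.mp hle (c v) (by simpa using hc v) i (by simpa using hv)]
    have hcol : G.Colorable n := by
      refine ⟨SimpleGraph.Coloring.mk (fun v => g (c v) v) ?_⟩
      intro u v huv heq
      obtain ⟨hne, i, hu, hv⟩ := (hG u v).mp huv
      rw [hgc i u hu, hgc i v hv] at heq
      exact hne (hginj i hu hv heq)
    exact hcol.chromaticNumber_le
  · have hclique : G.IsClique (Q 0) := fun u hu v hv hne => (hG u v).mpr ⟨hne, 0, hu, hv⟩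
    simpa [hcard] using hclique.card_le_chromaticNumber
end

section
/- Let n ≥ 2, let V be a finite set, and let Q₁,…,Qₙ be subsets of V such that each Qᵢ has exactly n elements, |Qᵢ ∩ Qⱼ| ≤ 1 whenever i ≠ j, and every element of V lies in at least one Qᵢ. Let G be the simple graph on V in which two distinct vertices u, v are adjacent if and only if there exists some i with u ∈ Qᵢ and v ∈ Qᵢ. Let S ⊆ V be the set of vertices belonging to more than one of the sets Q₁,…,Qₙ. If there exists a proper colouring of the subgraph of G induced on S using at most n colours, then the chromatic number of G equals n. -/
/-- A map that is injective on `s ∩ t`, where `t` has `n` elements, agrees on `s ∩ t` with some map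
to `Fin n` that is injective on all of `t`. -/
theorem Finset.exists_injOn_eqOn_inter {V : Type*} {n : ℕ} {t : Finset V} (ht : t.card = n)
    {s : Set V} {f : V → Fin n} (hf : Set.InjOn f (s ∩ t)) :
    ∃ g : V → Fin n, Set.InjOn g t ∧ Set.EqOn g f (s ∩ t) := by
  classical
  obtain ⟨e, he⟩ := Finset.exists_equiv_extend_of_card_eq (α := t) (β := Fin n)
    (t := Finset.univ) (by simp [ht]) (s := Finset.univ.filter fun x => (x : V) ∈ s)
    (f := fun x => f x) (Finset.subset_univ _) (fun x hx y hy h => by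
      simp only [Finset.coe_filter, Finset.mem_univ, true_and, Set.mem_ofPred_eq] at hx hy
      exact Subtype.ext (hf ⟨hx, x.2⟩ ⟨hy, y.2⟩ h))
  refine ⟨fun v => if h : v ∈ t then (e ⟨v, h⟩ : Fin n) else f v, fun x hx y hy h => ?_,
    fun x hx => ?_⟩
  · have hx' : x ∈ t := hx
    have hy' : y ∈ t := hy
    simp only [hx', hy', dif_pos] at h
    exact congrArg Subtype.val (e.injective (Subtype.ext h))
  · have hx' : x ∈ t := hx.2
    simp only [hx', dif_pos]
    exact he ⟨x, hx'⟩ (by simpa using hx.1)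

/-- If a graph is covered by `n`-element cliques `Q i`, every edge lies inside some `Q i`, and every vertex outside `S` lies in at most one `Q i`, then an
`n`-colouring of the graph induced on `S` extends to the whole graph. -/
theorem SimpleGraph.colorable_of_induce_colorable_of_clique_cover {V ι : Type*} {n : ℕ}
    (hn : 0 < n) {G : SimpleGraph V} {Q : ι → Finset V} (hcard : ∀ i, (Q i).card = n)
    (hcover : ∀ v, ∃ i, v ∈ Q i) (hclique : ∀ i, G.IsClique (Q i))
    (hadj : ∀ u v, G.Adj u v → ∃ i, u ∈ Q i ∧ v ∈ Q i) {S : Set V}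
    (hS : ∀ v ∉ S, ∀ i j, v ∈ Q i → v ∈ Q j → i = j) (hcol : (G.induce S).Colorable n) :
    G.Colorable n := by
  classical
  obtain ⟨c⟩ := hcol
  let f : V → Fin n := fun v => if h : v ∈ S then c ⟨v, h⟩ else ⟨0, hn⟩
  have hf : ∀ i, Set.InjOn f (S ∩ Q i) := by
    rintro i x ⟨hxS, hxi⟩ y ⟨hyS, hyi⟩ h
    by_contra hxy
    simp only [f, hxS, hyS, dif_pos] at h
    exact c.valid (v := ⟨x, hxS⟩) (w := ⟨y, hyS⟩) (hclique i hxi hyi hxy) h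
  choose g hginj hgf using fun i => Finset.exists_injOn_eqOn_inter (hcard i) (hf i)
  choose k hk using hcover
  have hg : ∀ v i, v ∈ Q i → g (k v) v = g i v := by
    intro v i hv
    by_cases hvS : v ∈ S
    · rw [hgf _ ⟨hvS, hk v⟩, hgf _ ⟨hvS, hv⟩]
    · rw [hS v hvS _ _ (hk v) hv]
  refine ⟨SimpleGraph.Coloring.mk (fun v => g (k v) v) fun {u v} huv h => ?_⟩
  obtain ⟨i, hu, hv⟩ := hadj u v huv
  rw [hg u i hu, hg v i hv] at h
  exact huv.ne (hginj i hu hv h)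


/-- Let `n ≥ 2` and let `V` be a finite set covered by `n` sets
`Q₁,…,Qₙ`, each of size `n`, pairwise intersecting in at most one element. Let
`G` be the graph on `V` where two distinct vertices are adjacent iff they lie
together in some `Qᵢ`, and let `S` be the set of shared vertices (those lying in
more than one `Qᵢ`). If the subgraph of `G` induced on `S` has a proper colouring
with at most `n` colours, then `χ(G) = n`. -/
theorem stmt_4 (n : ℕ) (hn : 2 ≤ n) (V : Type*) [Fintype V] [DecidableEq V]
    (Q : Fin n → Finset V)
    (hcard : ∀ i, (Q i).card = n)
    (hinter : ∀ i j, i ≠ j → (Q i ∩ Q j).card ≤ 1)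
    (hcover : ∀ v : V, ∃ i, v ∈ Q i)
    (G : SimpleGraph V)
    (hG : ∀ u v, G.Adj u v ↔ u ≠ v ∧ ∃ i, u ∈ Q i ∧ v ∈ Q i)
    (S : Set V) (hS : S = {v : V | 1 < (Finset.univ.filter (fun i => v ∈ Q i)).card})
    (hcol : (G.induce S).Colorable n) :
    G.chromaticNumber = (n : ℕ∞) := by
  have hclique : ∀ i, G.IsClique (Q i) := fun i u hu v hv huv => (hG u v).2 ⟨huv, i, hu, hv⟩
  have hle : G.Colorable n := by
    refine SimpleGraph.colorable_of_induce_colorable_of_clique_cover (by omega) hcard hcover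
      hclique (fun u v h => ((hG u v).1 h).2) (fun v hv i j hi hj => ?_) hcol
    rw [hS, Set.mem_ofPred_eq, not_lt, Finset.card_le_one] at hv
    exact hv i (by simpa using hi) j (by simpa using hj)
  refine le_antisymm hle.chromaticNumber_le ?_
  have := (hclique ⟨0, by omega⟩).card_le_chromaticNumber
  rwa [hcard] at this
end
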